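/- Let b < 1 be real, and let P, Q, R : ℝ → ℝ be continuous on [b, 1) with P(x) > 0 for all x ∈ [b, 1). Let f₁, f₂, g be twice continuously differentiable on [b, 1) and satisfy on [b, 1): P·f₁'' + Q·f₁' + R·f₁ = 0 and P·f₂'' + Q·f₂' + R·f₂ = 0. Assume: f₁(b) = 0, f₁'(b) > 0, f₁(x) > 0 for x ∈ (b, 1), f₁ is bounded on [b, 1); f₂(b) > 0 and f₂(x) → −∞ as x → 1⁻; g is a supersolution, i.e., P(x)·g''(x) + Q(x)·g'(x) + R(x)·g(x) ≤ 0 for all x ∈ [b, 1); and g(b) > 0. Then g(x) → −∞ as x → 1⁻. -/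

import Mathlib

lemma aux_deriv {b : ℝ} (hb : b < 1) {f : ℝ → ℝ} (hf : ContDiffOn ℝ 2 f (Set.Ico b 1)) :
    ∃ f' : ℝ → ℝ, ContinuousOn f' (Set.Ico b 1) ∧ ∀ x ∈ Set.Ioo b (1:ℝ),
      f' x = deriv f x ∧ HasDerivAt f (f' x) x ∧ HasDerivAt f' (deriv (deriv f) x) x := by
  refine ⟨derivWithin f (Set.Ico b 1),
    hf.continuousOn_derivWithin (uniqueDiffOn_Ico b 1) (by norm_num), ?_⟩
  have hnh : ∀ x ∈ Set.Ioo b (1:ℝ), Set.Ico b (1:ℝ) ∈ nhds x := fun x hx =>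
    Ico_mem_nhds hx.1 hx.2
  have heq : ∀ x ∈ Set.Ioo b (1:ℝ), derivWithin f (Set.Ico b 1) x = deriv f x := fun x hx =>
    derivWithin_of_mem_nhds (hnh x hx)
  intro x hx
  have hd : HasDerivAt f (deriv f x) x :=
    (((hf.contDiffAt (hnh x hx)).differentiableAt (by norm_num))).hasDerivAt
  have hev : derivWithin f (Set.Ico b 1) =ᶠ[nhds x] deriv f := by
    filter_upwards [Ioo_mem_nhds hx.1 hx.2] with y hy using heq y hy
  refine ⟨heq x hx, (heq x hx) ▸ hd, ?_⟩
  have h2 : ContDiffOn ℝ 2 f (Set.Ioo b 1) := hf.mono Set.Ioo_subset_Ico_self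
  have h3 : ContDiffOn ℝ 1 (deriv f) (Set.Ioo b 1) :=
    h2.deriv_of_isOpen isOpen_Ioo (by norm_num)
  have h4 : DifferentiableAt ℝ (deriv f) x :=
    (h3.contDiffAt (Ioo_mem_nhds hx.1 hx.2)).differentiableAt (by norm_num)
  exact h4.hasDerivAt.congr_of_eventuallyEq hev

/-- Supersolution lemma (Lemma 9.1): let `P f'' + Q f' + R f = 0` have a bounded
solution `f₁` vanishing at `b` and positive on `(b,1)`, and an unbounded solution `f₂`
positive at `b` with `f₂ → −∞` at `1⁻`. Then any supersolution `g` with `g(b) > 0`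
tends to `−∞` at `1⁻`. -/
theorem supersolution_tendsto_atBot (b : ℝ) (hb : b < 1)
    (P Q R : ℝ → ℝ)
    (hPc : ContinuousOn P (Set.Ico b 1)) (hQc : ContinuousOn Q (Set.Ico b 1))
    (hRc : ContinuousOn R (Set.Ico b 1))
    (hPpos : ∀ x ∈ Set.Ico b (1 : ℝ), 0 < P x)
    (f₁ f₂ g : ℝ → ℝ)
    (hf₁ : ContDiffOn ℝ 2 f₁ (Set.Ico b 1))
    (hf₂ : ContDiffOn ℝ 2 f₂ (Set.Ico b 1))
    (hg : ContDiffOn ℝ 2 g (Set.Ico b 1))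
    (hode₁ : ∀ x ∈ Set.Ico b (1 : ℝ),
      P x * deriv (deriv f₁) x + Q x * deriv f₁ x + R x * f₁ x = 0)
    (hode₂ : ∀ x ∈ Set.Ico b (1 : ℝ),
      P x * deriv (deriv f₂) x + Q x * deriv f₂ x + R x * f₂ x = 0)
    (hf₁b : f₁ b = 0) (hf₁'b : 0 < deriv f₁ b)
    (hf₁pos : ∀ x ∈ Set.Ioo b (1 : ℝ), 0 < f₁ x)
    (hf₁bdd : ∃ M : ℝ, ∀ x ∈ Set.Ico b (1 : ℝ), |f₁ x| ≤ M)
    (hf₂b : 0 < f₂ b)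
    (hf₂lim : Filter.Tendsto f₂ (nhdsWithin 1 (Set.Iio 1)) Filter.atBot)
    (hsuper : ∀ x ∈ Set.Ico b (1 : ℝ),
      P x * deriv (deriv g) x + Q x * deriv g x + R x * g x ≤ 0)
    (hgb : 0 < g b) :
    Filter.Tendsto g (nhdsWithin 1 (Set.Iio 1)) Filter.atBot := by
  obtain ⟨M, hM⟩ := hf₁bdd
  obtain ⟨d₁, hc₁, hd₁⟩ := aux_deriv hb hf₁
  obtain ⟨d₂, hc₂, hd₂⟩ := aux_deriv hb hf₂
  obtain ⟨dg, hcg, hdg⟩ := aux_deriv hb hg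
  obtain ⟨c, hc⟩ : ∃ c, c = g b / f₂ b := ⟨_, rfl⟩
  have hcpos : 0 < c := hc ▸ div_pos hgb hf₂b
  have hcb : g b - c * f₂ b = 0 := by rw [hc]; field_simp; ring
  -- the Wronskian is nonpositive
  have hW : ∀ y ∈ Set.Ioo b (1:ℝ),
      (dg y - c * d₂ y) * f₁ y - (g y - c * f₂ y) * d₁ y ≤ 0 := by
    intro y hy
    have hsub : Set.Icc b y ⊆ Set.Ico b 1 := fun z hz => ⟨hz.1, hz.2.trans_lt hy.2⟩
    have hqc : ContinuousOn (fun x => Q x / P x) (Set.Icc b y) :=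
      (hQc.mono hsub).div (hPc.mono hsub) (fun x hx => (hPpos x (hsub hx)).ne')
    obtain ⟨q, hq, hqe⟩ : ∃ q : ℝ → ℝ, Continuous q ∧ ∀ x ∈ Set.Icc b y, q x = Q x / P x :=
      ⟨Set.IccExtend hy.1.le ((Set.Icc b y).restrict (fun x => Q x / P x)),
        (continuousOn_iff_continuous_restrict.1 hqc).Icc_extend',
        fun x hx => by rw [Set.IccExtend_of_mem _ _ hx]; rfl⟩
    have hA : ∀ x, HasDerivAt (fun x => Real.exp (∫ t in b..x, q t))
        (Real.exp (∫ t in b..x, q t) * q x) x := fun x =>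
      (hq.integral_hasStrictDerivAt b x).hasDerivAt.exp
    obtain ⟨E, hE⟩ : ∃ E : ℝ → ℝ, E = fun x => Real.exp (∫ t in b..x, q t) := ⟨_, rfl⟩
    have hEpos : ∀ x, 0 < E x := fun x => by rw [hE]; exact Real.exp_pos _
    have hEd : ∀ x, HasDerivAt E (E x * q x) x := fun x => by rw [hE]; exact hA x
    have hder : ∀ x ∈ Set.Ioo b y, HasDerivAt
        (fun x => E x * ((dg x - c * d₂ x) * f₁ x - (g x - c * f₂ x) * d₁ x))
        (E x * q x * ((dg x - c * d₂ x) * f₁ x - (g x - c * f₂ x) * d₁ x) +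
          E x * (((deriv (deriv g) x - c * deriv (deriv f₂) x) * f₁ x
            + (dg x - c * d₂ x) * d₁ x) - ((dg x - c * d₂ x) * d₁ x
            + (g x - c * f₂ x) * deriv (deriv f₁) x))) x := by
      intro x hx
      have hx1 : x ∈ Set.Ioo b (1:ℝ) := ⟨hx.1, hx.2.trans hy.2⟩
      obtain ⟨-, a1, a2⟩ := hd₁ x hx1
      obtain ⟨-, b1, b2⟩ := hd₂ x hx1
      obtain ⟨-, g1, g2⟩ := hdg x hx1
      exact (hEd x).mul (((g2.sub (b2.const_mul c)).mul a1).sub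
        ((g1.sub (b1.const_mul c)).mul a2))
    have hanti : AntitoneOn
        (fun x => E x * ((dg x - c * d₂ x) * f₁ x - (g x - c * f₂ x) * d₁ x))
        (Set.Icc b y) := by
      refine antitoneOn_of_deriv_nonpos (convex_Icc b y) ?_ ?_ ?_
      · have e0 : ContinuousOn E (Set.Icc b y) :=
          fun x _ => (hEd x).continuousAt.continuousWithinAt
        have e1 := hc₁.mono hsub
        have e2 := hc₂.mono hsub
        have e3 := hcg.mono hsub
        have e4 := hf₁.continuousOn.mono hsub
        have e5 := hf₂.continuousOn.mono hsub
        have e6 := hg.continuousOn.mono hsub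
        fun_prop
      · rw [interior_Icc]
        exact fun x hx => (hder x hx).differentiableAt.differentiableWithinAt
      · rw [interior_Icc]
        intro x hx
        have hx1 : x ∈ Set.Ioo b (1:ℝ) := ⟨hx.1, hx.2.trans hy.2⟩
        have hx2 : x ∈ Set.Ico b (1:ℝ) := ⟨hx.1.le, hx1.2⟩
        rw [(hder x hx).deriv, hqe x ⟨hx.1.le, hx.2.le⟩]
        have o1 := hode₁ x hx2
        have o2 := hode₂ x hx2
        have o3 := hsuper x hx2
        rw [← (hd₁ x hx1).1] at o1
        rw [← (hd₂ x hx1).1] at o2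
        rw [← (hdg x hx1).1] at o3
        have hP := hPpos x hx2
        have key : E x * (Q x / P x) * ((dg x - c * d₂ x) * f₁ x - (g x - c * f₂ x) * d₁ x) +
          E x * (((deriv (deriv g) x - c * deriv (deriv f₂) x) * f₁ x
            + (dg x - c * d₂ x) * d₁ x) - ((dg x - c * d₂ x) * d₁ x
            + (g x - c * f₂ x) * deriv (deriv f₁) x))
          = E x * f₁ x / P x * (P x * deriv (deriv g) x + Q x * dg x + R x * g x) := by
          field_simp
          linear_combination (-c * E x * f₁ x) * o2 - E x * (g x - c * f₂ x) * o1
        rw [key]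
        exact mul_nonpos_of_nonneg_of_nonpos
          (div_pos (mul_pos (hEpos x) (hf₁pos x hx1)) hP).le o3
    have h := hanti (Set.left_mem_Icc.2 hy.1.le) (Set.right_mem_Icc.2 hy.1.le) hy.1.le
    simp only [hf₁b, hcb, mul_zero, zero_mul, sub_zero] at h
    exact nonpos_of_mul_nonpos_right h (hEpos y)
  have hquot : AntitoneOn (fun x => (g x - c * f₂ x) / f₁ x) (Set.Ioo b 1) := by
    have hder : ∀ x ∈ Set.Ioo b (1:ℝ), HasDerivAt (fun x => (g x - c * f₂ x) / f₁ x)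
        (((dg x - c * d₂ x) * f₁ x - (g x - c * f₂ x) * d₁ x) / f₁ x ^ 2) x := by
      intro x hx
      exact ((hdg x hx).2.1.sub ((hd₂ x hx).2.1.const_mul c)).div (hd₁ x hx).2.1
        (hf₁pos x hx).ne'
    refine antitoneOn_of_deriv_nonpos (convex_Ioo b 1)
      (fun x hx => (hder x hx).continuousAt.continuousWithinAt) ?_ ?_
    · rw [interior_Ioo]
      exact fun x hx => (hder x hx).differentiableAt.differentiableWithinAt
    · rw [interior_Ioo]
      intro x hx
      rw [(hder x hx).deriv]
      exact div_nonpos_of_nonpos_of_nonneg (hW x hx) (sq_nonneg _)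
  obtain ⟨m, hm⟩ := exists_between hb
  obtain ⟨K, hK⟩ : ∃ K, K = (g m - c * f₂ m) / f₁ m := ⟨_, rfl⟩
  have hlim : Filter.Tendsto (fun x => c * f₂ x + |K| * M) (nhdsWithin 1 (Set.Iio 1))
      Filter.atBot :=
    Filter.tendsto_atBot_add_const_right _ _ (hf₂lim.const_mul_atBot hcpos)
  refine Filter.tendsto_atBot_mono' _ ?_ hlim
  filter_upwards [Ioo_mem_nhdsLT hm.2] with x hx
  have hx1 : x ∈ Set.Ioo b (1:ℝ) := ⟨hm.1.trans hx.1, hx.2⟩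
  have h1 : (g x - c * f₂ x) / f₁ x ≤ K := by
    rw [hK]; exact hquot hm hx1 hx.1.le
  rw [div_le_iff₀ (hf₁pos x hx1)] at h1
  have h2 : K * f₁ x ≤ |K| * M := by
    refine (le_abs_self _).trans ?_
    rw [abs_mul]
    exact mul_le_mul_of_nonneg_left (hM x ⟨hx1.1.le, hx1.2⟩) (abs_nonneg K)
  linarith
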